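/- For the DRB game on the k-dimensional grid, there exists n0 ∈ ℕ (depending only on k and the granularity γ) such that for all n ≥ n0: starting from any strategy profile r with r ≢ 0 (i.e., r_u > 0 for some node u), if all nodes move synchronously in the best-response dynamic (in each synchronous step every node simultaneously switches to a best response to the current profile), then after at most k·⌊n/2⌋ synchronous steps the profile equals the navigable profile r ≡ k. -/

import Mathlib

open Finset

noncomputable section

namespace DRB

/-- Nodes of the `k`-dimensional grid (torus) with side length `n`. -/
abbrev Node (n k : ℕ) := Fin k → Fin n

/-- Grid (Manhattan) distance on the torus:
`d_M(u,v) = Σ_i min(|u_i - v_i|, n - |u_i - v_i|)`. -/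
def dM (n k : ℕ) (u v : Node n k) : ℕ :=
  ∑ i, min ((u i : ℤ) - (v i : ℤ)).natAbs (n - ((u i : ℤ) - (v i : ℤ)).natAbs)

/-- All nodes different from `u`. -/
def others (n k : ℕ) (u : Node n k) : Finset (Node n k) :=
  Finset.univ.filter (fun v => v ≠ u)

/-- Normalization constant `c(s) = Σ_{v ≠ u} d_M(u,v)^{-s}` for node `u`. -/
def cnorm (n k : ℕ) (u : Node n k) (s : ℝ) : ℝ :=
  ∑ v ∈ others n k u, (dM n k u v : ℝ) ^ (-s)

/-- Long-range link probability `p_u(v, s) = d_M(u,v)^{-s} / c(s)`. -/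
def linkProb (n k : ℕ) (u v : Node n k) (s : ℝ) : ℝ :=
  (dM n k u v : ℝ) ^ (-s) / cnorm n k u s

/-- Link distance `D(s) = Σ_{v ≠ u} p_u(v,s) · d_M(u,v)` of node `u`. -/
def linkDist (n k : ℕ) (u : Node n k) (s : ℝ) : ℝ :=
  ∑ v ∈ others n k u, linkProb n k u v s * (dM n k u v : ℝ)

/-- Reciprocity `P_u(r) = Σ_{v ≠ u} p_u(v, r_u) · p_v(u, r_v)`. -/
def recip (n k : ℕ) (r : Node n k → ℝ) (u : Node n k) : ℝ :=
  ∑ v ∈ others n k u, linkProb n k u v (r u) * linkProb n k v u (r v)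

/-- DRB payoff `π_u(r) = D(r_u) · P_u(r)`. -/
def payoff (n k : ℕ) (r : Node n k → ℝ) (u : Node n k) : ℝ :=
  linkDist n k u (r u) * recip n k r u

/-- Membership in the strategy set `Σ = {0, γ, 2γ, 3γ, ...}`. -/
def InSigma (γ s : ℝ) : Prop := ∃ m : ℕ, s = m * γ

/-- A valid strategy profile (every coordinate lies in `Σ`). -/
def ValidProfile (n k : ℕ) (γ : ℝ) (r : Node n k → ℝ) : Prop :=
  ∀ u, InSigma γ (r u)

/-- Nash equilibrium of the DRB game with strategy set `Σ` of granularity `γ`. -/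
def IsNash (n k : ℕ) (γ : ℝ) (r : Node n k → ℝ) : Prop :=
  ∀ u : Node n k, ∀ s : ℝ, InSigma γ s →
    payoff n k r u ≥ payoff n k (Function.update r u s) u

/-- Strict Nash equilibrium. -/
def IsStrictNash (n k : ℕ) (γ : ℝ) (r : Node n k → ℝ) : Prop :=
  ∀ u : Node n k, ∀ s : ℝ, InSigma γ s → s ≠ r u →
    payoff n k r u > payoff n k (Function.update r u s) u

/-- `t`-strong Nash equilibrium: no coalition of size ≤ `t` has a weakly
improving joint deviation that strictly improves some member. -/
def IsTStrongNash (n k : ℕ) (γ : ℝ) (t : ℕ) (r : Node n k → ℝ) : Prop :=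
  ¬ ∃ (C : Finset (Node n k)) (s : Node n k → ℝ),
      C.Nonempty ∧ C.card ≤ t ∧ (∀ u ∈ C, InSigma γ (s u)) ∧
      (∀ u ∈ C,
        payoff n k (fun v => if v ∈ C then s v else r v) u ≥ payoff n k r u) ∧
      (∃ u ∈ C,
        payoff n k (fun v => if v ∈ C then s v else r v) u > payoff n k r u)

/-- Strong Nash equilibrium: coalitions of any size. -/
def IsStrongNash (n k : ℕ) (γ : ℝ) (r : Node n k → ℝ) : Prop :=
  ¬ ∃ (C : Finset (Node n k)) (s : Node n k → ℝ),
      C.Nonempty ∧ (∀ u ∈ C, InSigma γ (s u)) ∧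
      (∀ u ∈ C,
        payoff n k (fun v => if v ∈ C then s v else r v) u ≥ payoff n k r u) ∧
      (∃ u ∈ C,
        payoff n k (fun v => if v ∈ C then s v else r v) u > payoff n k r u)

/-- `b_u(j)`: the number of nodes at grid distance exactly `j` from `u`. -/
def countAt (n k : ℕ) (u : Node n k) (j : ℕ) : ℕ :=
  (Finset.univ.filter (fun v => v ≠ u ∧ dM n k u v = j)).card

/-- One asynchronous best-response step: a single node switches to a best
response to the current profile, all other strategies unchanged. -/
def BRStep (n k : ℕ) (γ : ℝ) (r r' : Node n k → ℝ) : Prop :=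
  ∃ (u : Node n k) (s : ℝ), InSigma γ s ∧
    (∀ t : ℝ, InSigma γ t →
      payoff n k (Function.update r u s) u ≥ payoff n k (Function.update r u t) u) ∧
    r' = Function.update r u s

/-- One synchronous best-response step: every node simultaneously switches
to a best response to the current profile `r`. -/
def SyncStep (n k : ℕ) (γ : ℝ) (r r' : Node n k → ℝ) : Prop :=
  ∀ u : Node n k, InSigma γ (r' u) ∧
    ∀ t : ℝ, InSigma γ t →
      payoff n k (Function.update r u (r' u)) u ≥
        payoff n k (Function.update r u t) u

end DRB


namespace DRB

/-- one-dimensional torus distance -/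
def tor (n : ℕ) (a b : Fin n) : ℕ :=
  min ((a : ℤ) - (b : ℤ)).natAbs (n - ((a : ℤ) - (b : ℤ)).natAbs)

lemma dM_eq (n k : ℕ) (u v : Node n k) : dM n k u v = ∑ i, tor n (u i) (v i) := rfl

lemma tor_comm (n : ℕ) (a b : Fin n) : tor n a b = tor n b a := by
  unfold tor; omega

lemma tor_self (n : ℕ) (a : Fin n) : tor n a a = 0 := by
  unfold tor; simp

lemma tor_le (n : ℕ) (a b : Fin n) : tor n a b ≤ n / 2 := by
  unfold tor; omega

lemma tor_triangle (n : ℕ) (a b c : Fin n) : tor n a c ≤ tor n a b + tor n b c := by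
  unfold tor; omega

lemma tor_eq_zero (n : ℕ) (a b : Fin n) (h : tor n a b = 0) : a = b := by
  unfold tor at h; ext; omega

lemma tor_toward (n : ℕ) (a b : Fin n) (h : a ≠ b) :
    ∃ c : Fin n, tor n a c = 1 ∧ tor n b c + 1 = tor n b a := by
  have hab : (a : ℕ) ≠ b := fun h' => h (Fin.ext h')
  have ha := a.2
  have hb := b.2
  by_cases h1 : (a : ℕ) < b
  · by_cases h2 : (b : ℕ) - a ≤ n - (b - a)
    · exact ⟨⟨a + 1, by omega⟩, by unfold tor; simp only; omega, by unfold tor; simp only; omega⟩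
    · by_cases h3 : (a : ℕ) = 0
      · exact ⟨⟨n - 1, by omega⟩, by unfold tor; simp only; omega, by unfold tor; simp only; omega⟩
      · exact ⟨⟨a - 1, by omega⟩, by unfold tor; simp only; omega, by unfold tor; simp only; omega⟩
  · by_cases h2 : (a : ℕ) - b ≤ n - (a - b)
    · exact ⟨⟨a - 1, by omega⟩, by unfold tor; simp only; omega, by unfold tor; simp only; omega⟩
    · by_cases h3 : (a : ℕ) = n - 1
      · exact ⟨⟨0, by omega⟩, by unfold tor; simp only; omega, by unfold tor; simp only; omega⟩
      · exact ⟨⟨a + 1, by omega⟩, by unfold tor; simp only; omega, by unfold tor; simp only; omega⟩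

lemma tor_two (n : ℕ) (hn : 3 ≤ n) (a : Fin n) :
    ∃ c c' : Fin n, c ≠ c' ∧ tor n a c = 1 ∧ tor n a c' = 1 := by
  have ha := a.2
  refine ⟨if h : (a : ℕ) = 0 then ⟨n - 1, by omega⟩ else ⟨a - 1, by omega⟩,
    if h : (a : ℕ) = n - 1 then ⟨0, by omega⟩ else ⟨a + 1, by omega⟩, ?_, ?_, ?_⟩
  · intro h
    rw [Fin.ext_iff] at h
    split_ifs at h <;> simp only at h <;> omega
  · unfold tor; split_ifs <;> simp only <;> omega
  · unfold tor; split_ifs <;> simp only <;> omega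

lemma dM_comm (n k : ℕ) (u v : Node n k) : dM n k u v = dM n k v u := by
  simp only [dM_eq]; exact Finset.sum_congr rfl fun i _ => tor_comm _ _ _

lemma dM_triangle (n k : ℕ) (u v w : Node n k) : dM n k u w ≤ dM n k u v + dM n k v w := by
  simp only [dM_eq, ← Finset.sum_add_distrib]
  exact Finset.sum_le_sum fun i _ => tor_triangle _ _ _ _

lemma dM_self (n k : ℕ) (u : Node n k) : dM n k u u = 0 := by
  simp [dM_eq, tor_self]

lemma dM_le (n k : ℕ) (u v : Node n k) : dM n k u v ≤ k * (n / 2) := by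
  rw [dM_eq]
  calc _ ≤ ∑ i : Fin k, n / 2 := Finset.sum_le_sum fun i _ => tor_le _ _ _
    _ = _ := by simp

lemma tor_le_dM (n k : ℕ) (u v : Node n k) (i : Fin k) : tor n (u i) (v i) ≤ dM n k u v := by
  rw [dM_eq]
  exact Finset.single_le_sum (f := fun i => tor n (u i) (v i)) (fun _ _ => Nat.zero_le _) (mem_univ i)

lemma dM_pos (n k : ℕ) (u v : Node n k) (h : v ≠ u) : 1 ≤ dM n k u v := by
  by_contra h0
  apply h
  ext1 i
  have := tor_le_dM n k u v i
  exact (tor_eq_zero _ _ _ (by omega)).symm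

lemma dM_update (n k : ℕ) (u v : Node n k) (i : Fin k) (c : Fin n) :
    dM n k v (Function.update u i c) + tor n (v i) (u i) = dM n k v u + tor n (v i) c := by
  simp only [dM_eq]
  rw [← Finset.add_sum_erase _ _ (mem_univ i), ← Finset.add_sum_erase univ (fun j => tor n (v j) (u j)) (mem_univ i)]
  have : ∑ x ∈ univ.erase i, tor n (v x) (Function.update u i c x)
      = ∑ x ∈ univ.erase i, tor n (v x) (u x) := by
    apply Finset.sum_congr rfl
    intro x hx
    rw [Function.update_of_ne (Finset.ne_of_mem_erase hx)]
  rw [this]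
  simp only [Function.update_self]
  omega

lemma exists_toward (n k : ℕ) (u v : Node n k) (h : u ≠ v) :
    ∃ w, dM n k u w = 1 ∧ dM n k v w + 1 = dM n k v u := by
  obtain ⟨i, hi⟩ := Function.ne_iff.1 h
  obtain ⟨c, h1, h2⟩ := tor_toward n (u i) (v i) hi
  refine ⟨Function.update u i c, ?_, ?_⟩
  · have := dM_update n k u u i c
    rw [dM_self, tor_self] at this; omega
  · have := dM_update n k u v i c
    omega

lemma exists_two (n k : ℕ) (hn : 3 ≤ n) (hk : 1 ≤ k) (v : Node n k) :
    ∃ w w', w ≠ w' ∧ dM n k v w = 1 ∧ dM n k v w' = 1 := by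
  let i : Fin k := ⟨0, hk⟩
  obtain ⟨c, c', hc, h1, h2⟩ := tor_two n hn (v i)
  refine ⟨Function.update v i c, Function.update v i c', ?_, ?_, ?_⟩
  · intro h
    have := congrFun h i
    simp at this
    exact hc this
  · have := dM_update n k v v i c
    rw [dM_self, tor_self] at this; omega
  · have := dM_update n k v v i c'
    rw [dM_self, tor_self] at this; omega

lemma tor_shift (n : ℕ) (a : Fin n) (z : ℕ) (hz : z < n) :
    tor n a ⟨(a + z) % n, Nat.mod_lt _ (by omega)⟩ ≤ z := by
  have ha := a.2
  unfold tor
  simp only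
  by_cases h : (a : ℕ) + z < n
  · rw [Nat.mod_eq_of_lt h]; omega
  · have : ((a : ℕ) + z) % n = a + z - n := by
      rw [Nat.mod_eq_sub_mod (by omega), Nat.mod_eq_of_lt (by omega)]
    rw [this]; omega

lemma ball_card (n k m : ℕ) (hm : m < n) (v : Node n k) :
    (m + 1) ^ k ≤ (Finset.univ.filter (fun w => dM n k v w ≤ k * m)).card := by
  classical
  let F : (Fin k → Fin (m+1)) → Node n k := fun z i => ⟨(v i + z i) % n, Nat.mod_lt _ (by omega)⟩
  have hinj : Function.Injective F := by
    intro z z' h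
    ext i
    have h1 := congrArg Fin.val (congrFun h i)
    simp only [F] at h1
    have a1 := (z i).2
    have a2 := (z' i).2
    have h2 : ((z i : ℕ)) ≡ (z' i : ℕ) [MOD n] := Nat.ModEq.add_left_cancel' (v i : ℕ) h1
    exact Nat.ModEq.eq_of_lt_of_lt h2 (by omega) (by omega)
  have hc : (Finset.univ.image F).card = (m+1)^k := by
    rw [Finset.card_image_of_injective _ hinj]; simp
  rw [← hc]
  apply Finset.card_le_card
  intro w hw
  obtain ⟨z, -, rfl⟩ := Finset.mem_image.1 hw
  refine Finset.mem_filter.2 ⟨mem_univ _, ?_⟩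
  rw [dM_eq]
  calc _ ≤ ∑ i : Fin k, m := Finset.sum_le_sum fun i _ => by
        have := (z i).2
        exact (tor_shift n (v i) (z i) (by omega)).trans (by omega)
    _ = _ := by simp

lemma mem_others (n k : ℕ) (u v : Node n k) : v ∈ others n k u ↔ v ≠ u := by
  simp [others]

lemma card_others (n k : ℕ) (u : Node n k) : (others n k u).card = n ^ k - 1 := by
  have : others n k u = univ.erase u := by ext; simp [others]
  rw [this, Finset.card_erase_of_mem (mem_univ _)]; simp

lemma dpos (n k : ℕ) (u v : Node n k) (h : v ∈ others n k u) : (1:ℝ) ≤ dM n k u v := by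
  exact_mod_cast dM_pos n k u v ((mem_others _ _ _ _).1 h)

lemma dle (n k : ℕ) (u v : Node n k) : (dM n k u v : ℝ) ≤ k * n := by
  have h := dM_le n k u v
  have : k * (n/2) ≤ k * n := Nat.mul_le_mul_left _ (Nat.div_le_self _ _)
  exact_mod_cast h.trans this

lemma cnorm_anti (n k : ℕ) (u : Node n k) (a b : ℝ) (h : a ≤ b) :
    cnorm n k u b ≤ cnorm n k u a := by
  apply Finset.sum_le_sum
  intro v hv
  exact Real.rpow_le_rpow_of_exponent_le (dpos _ _ _ _ hv) (by linarith)

lemma cnorm_ge_one (n k : ℕ) (hn : 3 ≤ n) (hk : 1 ≤ k) (u : Node n k) (a : ℝ) :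
    1 ≤ cnorm n k u a := by
  obtain ⟨w, -, -, hw, -⟩ := exists_two n k hn hk u
  have hmem : w ∈ others n k u := by
    rw [mem_others]; rintro rfl; rw [dM_self] at hw; omega
  calc (1:ℝ) = (dM n k u w : ℝ) ^ (-a) := by rw [hw]; simp
    _ ≤ _ := Finset.single_le_sum (f := fun v => (dM n k u v : ℝ) ^ (-a))
        (fun v _ => by positivity) hmem

/-- lower bound on the normalisation. -/
lemma cnorm_lower (n k : ℕ) (hn : 3 ≤ n) (hk : 1 ≤ k) (u : Node n k) (a : ℝ) (ha : 0 ≤ a) :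
    (n:ℝ) ^ (k:ℝ) / 2 * ((k:ℝ) * n) ^ (-a) ≤ cnorm n k u a := by
  have h1 : ((others n k u).card : ℝ) * ((k:ℝ) * n) ^ (-a) ≤ cnorm n k u a := by
    rw [← nsmul_eq_mul]
    apply Finset.card_nsmul_le_sum
    intro v hv
    have := dpos _ _ _ _ hv
    exact Real.rpow_le_rpow_of_nonpos (by linarith) (dle _ _ _ _) (by linarith)
  refine le_trans ?_ h1
  gcongr
  rw [card_others, Nat.cast_sub (Nat.one_le_pow _ _ (by omega))]
  push_cast
  rw [Real.rpow_natCast]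
  have : (2:ℝ) ≤ (n:ℝ)^k := by
    have h3 : (3:ℝ) ≤ n := by exact_mod_cast hn
    calc (2:ℝ) ≤ n := by linarith
      _ ≤ (n:ℝ)^k := le_self_pow₀ (by linarith) (by omega)
  linarith

/-- upper bound on the link probabilities. -/
lemma linkProb_upper (n k : ℕ) (hn : 3 ≤ n) (hk : 1 ≤ k) (u v : Node n k) (h : v ≠ u) (ρ : ℝ)
    (hρ : 0 ≤ ρ) :
    linkProb n k u v ρ ≤ 2 * (k:ℝ) ^ (k:ℝ) * (dM n k u v : ℝ) ^ (-(k:ℝ)) := by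
  set d := dM n k u v with hd
  have hd1 : 1 ≤ d := dM_pos n k u v h
  have hd1' : (1:ℝ) ≤ d := by exact_mod_cast hd1
  have hc1 := cnorm_ge_one n k hn hk u ρ
  set m := d / k with hm
  have hmn : m < n := by
    have : m ≤ n / 2 := Nat.div_le_of_le_mul (dM_le n k u v)
    omega
  have hkm : k * m ≤ d := Nat.mul_div_le d k
  have hb := ball_card n k m hmn u
  -- first bound
  have e1 : (d:ℝ)^(-ρ) * (((m+1:ℕ):ℝ)^k - 1) ≤ cnorm n k u ρ := by
    have s1 : ((univ.filter (fun w => dM n k u w ≤ k * m)).erase u) ⊆ others n k u := by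
      intro w hw; rw [mem_others]; exact Finset.ne_of_mem_erase hw
    have s2 : ((m:ℝ)+1)^k - 1 ≤ (((univ.filter (fun w => dM n k u w ≤ k * m)).erase u).card : ℝ) := by
      rw [Finset.card_erase_of_mem (by simp [dM_self])]
      have : (m+1)^k - 1 ≤ (univ.filter (fun w => dM n k u w ≤ k * m)).card - 1 := by omega
      have h2 : (((m+1)^k - 1 : ℕ) : ℝ) ≤ (((univ.filter (fun w => dM n k u w ≤ k * m)).card - 1 : ℕ) : ℝ) := by
        exact_mod_cast this
      rw [Nat.cast_sub (Nat.one_le_pow _ _ (Nat.succ_pos m))] at h2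
      push_cast at h2 ⊢
      exact h2
    calc (d:ℝ)^(-ρ) * (((m+1:ℕ):ℝ)^k - 1) ≤ (((univ.filter (fun w => dM n k u w ≤ k * m)).erase u).card : ℝ) * (d:ℝ)^(-ρ) := by
          rw [mul_comm]; push_cast; gcongr
      _ ≤ ∑ w ∈ (univ.filter (fun w => dM n k u w ≤ k * m)).erase u, (dM n k u w : ℝ)^(-ρ) := by
          rw [← nsmul_eq_mul]
          apply Finset.card_nsmul_le_sum
          intro w hw
          have hw1 := dpos _ _ _ _ (s1 hw)
          have hw2 : dM n k u w ≤ d := by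
            have := (Finset.mem_filter.1 (Finset.mem_of_mem_erase hw)).2
            omega
          exact Real.rpow_le_rpow_of_nonpos (by linarith) (by exact_mod_cast hw2) (by linarith)
      _ ≤ _ := Finset.sum_le_sum_of_subset_of_nonneg s1 (fun _ _ _ => by positivity)
  have e0 : (d:ℝ)^(-ρ) * 1 ≤ cnorm n k u ρ := by
    rw [mul_one]
    exact (Real.rpow_le_one_of_one_le_of_nonpos hd1' (by linarith)).trans hc1
  have e2 : (d:ℝ)^(-ρ) * ((m+1:ℕ):ℝ)^k ≤ 2 * cnorm n k u ρ := by linarith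
  have hk0 : (0:ℝ) < k := by exact_mod_cast hk
  have e3 : ((d:ℝ)/k)^k ≤ ((m+1:ℕ):ℝ)^k := by
    gcongr
    rw [div_le_iff₀ hk0]
    have : d < (m+1) * k := by rw [mul_comm]; exact Nat.lt_mul_div_succ d hk
    exact_mod_cast this.le
  have e4 : (d:ℝ)^(-ρ) * ((d:ℝ)/k)^k ≤ 2 * cnorm n k u ρ := le_trans (by gcongr) e2
  unfold linkProb
  rw [← hd, div_le_iff₀ (by linarith), Real.rpow_natCast, Real.rpow_neg (by linarith) (k:ℝ), Real.rpow_natCast]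
  rw [div_pow] at e4
  have hdk : (0:ℝ) < (d:ℝ)^k := by positivity
  have hkk : (0:ℝ) < (k:ℝ)^k := by positivity
  have e5 : (d:ℝ)^(-ρ) * (d:ℝ)^k ≤ 2 * cnorm n k u ρ * k^k := by
    rw [← div_le_iff₀ hkk]; rw [mul_div_assoc]; exact e4
  rw [← le_div_iff₀ hdk] at e5
  convert e5 using 1; field_simp

end DRB
namespace DRB

lemma sum_rpow_le (b : ℝ) (hb0 : 0 ≤ b) (hb1 : b < 1) (m : ℕ) :
    ∑ j ∈ range m, ((j:ℝ) + 1) ^ (-b) ≤ (m:ℝ) ^ (1 - b) / (1 - b) := by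
  induction m with
  | zero => simp [Real.zero_rpow (by linarith : (1:ℝ) - b ≠ 0)]
  | succ m ih =>
    rw [Finset.sum_range_succ]
    have h1b : 0 < 1 - b := by linarith
    have hm : (0:ℝ) < (m:ℝ) + 1 := by positivity
    have key := rpow_one_add_le_one_add_mul_self (s := -(1/((m:ℝ)+1))) (p := 1 - b)
      (by rw [neg_le_neg_iff, div_le_one hm]; linarith [(Nat.cast_nonneg m : (0:ℝ) ≤ m)]) h1b.le (by linarith)
    have e1 : (1 + -(1/((m:ℝ)+1))) = (m:ℝ) / (m+1) := by field_simp; ring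
    rw [e1, Real.div_rpow (by positivity) hm.le, div_le_iff₀ (by positivity)] at key
    have e2 : ((m:ℝ)+1) ^ (1-b) = ((m:ℝ)+1) * ((m:ℝ)+1)^(-b) := by
      rw [sub_eq_add_neg, Real.rpow_add hm, Real.rpow_one]
    have e3 : (1 + (1 - b) * -(1 / ((m:ℝ) + 1))) * ((m:ℝ) + 1) ^ (1 - b)
        = ((m:ℝ)+1) ^ (1-b) - (1 - b) * ((m:ℝ)+1)^(-b) := by
      rw [e2]; field_simp; ring
    rw [e3] at key
    push_cast
    rw [le_div_iff₀ h1b] at ih ⊢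
    linarith

lemma sum_abs_le (n : ℕ) (a : Fin n) (f : ℕ → ℝ) (hf : ∀ j, 0 ≤ f j) :
    ∑ x : Fin n, f ((a:ℤ) - (x:ℤ)).natAbs ≤ 2 * ∑ j ∈ range n, f j := by
  have h1 : ∀ x : Fin n, f ((a:ℤ) - (x:ℤ)).natAbs ≤
      ∑ j ∈ range n, ((if (x:ℕ) = a + j then f j else 0) + (if (x:ℕ) + j = a then f j else 0)) := by
    intro x
    have hx := x.2
    have ha := a.2
    have hmem : ((a:ℤ) - (x:ℤ)).natAbs ∈ range n := by rw [mem_range]; omega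
    have hnn : ∀ j ∈ range n, 0 ≤ ((if (x:ℕ) = a + j then f j else 0) + (if (x:ℕ) + j = a then f j else 0)) := by
      intro j _
      have := hf j
      split_ifs <;> linarith
    refine le_trans ?_ (Finset.single_le_sum hnn hmem)
    have h0 := hf ((a:ℤ) - (x:ℤ)).natAbs
    by_cases h : (x:ℕ) = a + ((a:ℤ) - (x:ℤ)).natAbs
    · rw [if_pos h]
      split_ifs <;> linarith
    · rw [if_neg h, if_pos (by omega)]; linarith
  calc _ ≤ ∑ x : Fin n, ∑ j ∈ range n, ((if (x:ℕ) = a + j then f j else 0) + (if (x:ℕ) + j = a then f j else 0)) :=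
        Finset.sum_le_sum fun x _ => h1 x
    _ = ∑ j ∈ range n, ∑ x : Fin n, ((if (x:ℕ) = a + j then f j else 0) + (if (x:ℕ) + j = a then f j else 0)) :=
        Finset.sum_comm
    _ ≤ ∑ j ∈ range n, 2 * f j := by
        apply Finset.sum_le_sum
        intro j _
        rw [Finset.sum_add_distrib]
        have g1 : ∑ x : Fin n, (if (x:ℕ) = a + j then f j else 0) ≤ f j := by
          rw [← Finset.sum_filter, Finset.sum_const, nsmul_eq_mul]
          have : (#{x : Fin n | (x:ℕ) = a + j} : ℝ) ≤ 1 := by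
            have : #{x : Fin n | (x:ℕ) = a + j} ≤ 1 := by
              rw [Finset.card_le_one]
              intro x hx y hy
              simp only [mem_filter] at hx hy
              ext; omega
            exact_mod_cast this
          nlinarith [hf j]
        have g2 : ∑ x : Fin n, (if (x:ℕ) + j = a then f j else 0) ≤ f j := by
          rw [← Finset.sum_filter, Finset.sum_const, nsmul_eq_mul]
          have : (#{x : Fin n | (x:ℕ) + j = a} : ℝ) ≤ 1 := by
            have : #{x : Fin n | (x:ℕ) + j = a} ≤ 1 := by
              rw [Finset.card_le_one]
              intro x hx y hy
              simp only [mem_filter] at hx hy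
              ext; omega
            exact_mod_cast this
          nlinarith [hf j]
        linarith
    _ = _ := by rw [Finset.mul_sum]

lemma sum_max_le (b : ℝ) (hb0 : 0 ≤ b) (hb1 : b < 1) (n : ℕ) (hn : 1 ≤ n) :
    ∑ j ∈ range n, ((max j 1 : ℕ):ℝ) ^ (-b) ≤ (1 + 1 / (1 - b)) * (n:ℝ)^(1-b) := by
  have hn1 : (1:ℝ) ≤ n := by exact_mod_cast hn
  have h1 : (1:ℝ) ≤ (n:ℝ)^(1-b) := Real.one_le_rpow hn1 (by linarith)
  obtain ⟨m, rfl⟩ : ∃ m, n = m + 1 := ⟨n - 1, by omega⟩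
  rw [Finset.sum_range_succ']
  have h2 := sum_rpow_le b hb0 hb1 m
  have h3 : ∑ j ∈ range m, ((max (j+1) 1 : ℕ):ℝ) ^ (-b) = ∑ j ∈ range m, ((j:ℝ) + 1) ^ (-b) := by
    apply Finset.sum_congr rfl
    intro j _
    rw [max_eq_left (by omega)]; push_cast; rfl
  rw [h3]
  have h4 : (m:ℝ)^(1-b) ≤ ((m+1:ℕ):ℝ)^(1-b) := by
    apply Real.rpow_le_rpow (by positivity) (by push_cast; linarith) (by linarith)
  have h5 : (m:ℝ)^(1-b)/(1-b) ≤ ((m+1:ℕ):ℝ)^(1-b)/(1-b) :=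
    div_le_div_of_nonneg_right h4 (by linarith)
  have h6 : ((max 0 1 : ℕ) : ℝ)^(-b) = 1 := by simp
  rw [h6]
  have : (1 + 1 / (1 - b)) * ((m+1:ℕ):ℝ)^(1-b) = ((m+1:ℕ):ℝ)^(1-b) + ((m+1:ℕ):ℝ)^(1-b)/(1-b) := by ring
  rw [this]
  linarith

lemma sum_tor_le (b : ℝ) (hb0 : 0 ≤ b) (hb1 : b < 1) (n : ℕ) (hn : 1 ≤ n) (a : Fin n) :
    ∑ x : Fin n, ((max (tor n a x) 1 : ℕ):ℝ) ^ (-b) ≤ 4 * (1 + 1 / (1 - b)) * (n:ℝ)^(1-b) := by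
  have h0 := sum_max_le b hb0 hb1 n hn
  have h1 := sum_abs_le n a (fun j => ((max j 1 : ℕ):ℝ)^(-b)) (fun j => by positivity)
  have h2 := sum_abs_le n a (fun j => ((max (n - j) 1 : ℕ):ℝ)^(-b)) (fun j => by positivity)
  have h3 : ∑ j ∈ range n, ((max (n - j) 1 : ℕ):ℝ)^(-b) ≤ (1 + 1 / (1 - b)) * (n:ℝ)^(1-b) := by
    rw [← Finset.sum_range_reflect]
    refine le_trans (Finset.sum_le_sum ?_) h0
    intro j hj
    rw [mem_range] at hj
    apply Real.rpow_le_rpow_of_nonpos _ _ (by linarith)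
    · have : 0 < max j 1 := by omega
      exact_mod_cast this
    · have : max j 1 ≤ max (n - (n - 1 - j)) 1 := by omega
      exact_mod_cast this
  have h4 : ∑ x : Fin n, ((max (tor n a x) 1 : ℕ):ℝ) ^ (-b) ≤
     ∑ x : Fin n, ((max ((a:ℤ) - (x:ℤ)).natAbs 1 : ℕ):ℝ)^(-b)
      + ∑ x : Fin n, ((max (n - ((a:ℤ) - (x:ℤ)).natAbs) 1 : ℕ):ℝ)^(-b) := by
    rw [← Finset.sum_add_distrib]
    apply Finset.sum_le_sum
    intro x _
    have p1 : 0 ≤ ((max ((a:ℤ) - (x:ℤ)).natAbs 1 : ℕ):ℝ)^(-b) := by positivity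
    have p2 : 0 ≤ ((max (n - ((a:ℤ) - (x:ℤ)).natAbs) 1 : ℕ):ℝ)^(-b) := by positivity
    unfold tor
    rcases min_choice ((a:ℤ) - (x:ℤ)).natAbs (n - ((a:ℤ) - (x:ℤ)).natAbs) with h | h
    · rw [h]; linarith
    · rw [h]; linarith
  linarith

/-- upper bound on the normalisation. -/
lemma cnorm_upper (k : ℕ) (hk : 1 ≤ k) (a : ℝ) (ha0 : 0 ≤ a) (hak : a < k) :
    ∃ C : ℝ, 0 < C ∧ ∀ n : ℕ, 1 ≤ n → ∀ u : Node n k, cnorm n k u a ≤ C * (n:ℝ)^((k:ℝ) - a) := by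
  have hk0 : (0:ℝ) < k := by exact_mod_cast hk
  set b := a / k with hb
  have hb0 : 0 ≤ b := by positivity
  have hb1 : b < 1 := by rw [hb, div_lt_one hk0]; exact hak
  have hbk : b * k = a := by rw [hb]; field_simp
  have h1b : 0 < 1 - b := by linarith
  refine ⟨(4 * (1 + 1 / (1 - b)))^k, by positivity, ?_⟩
  intro n hn u
  calc cnorm n k u a ≤ ∑ v ∈ others n k u, ∏ i, ((max (tor n (u i) (v i)) 1 : ℕ):ℝ)^(-b) := by
        apply Finset.sum_le_sum
        intro v hv
        have hd := dM_pos n k u v ((mem_others _ _ _ _).1 hv)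
        have e1 : (dM n k u v : ℝ)^(-a) = ∏ i : Fin k, (dM n k u v : ℝ)^(-b) := by
          rw [Finset.prod_const, Finset.card_univ, Fintype.card_fin, ← Real.rpow_natCast, ← Real.rpow_mul (by positivity)]
          congr 1; linarith
        rw [e1]
        apply Finset.prod_le_prod (fun _ _ => by positivity)
        intro i _
        apply Real.rpow_le_rpow_of_nonpos _ _ (by linarith)
        · have : 0 < max (tor n (u i) (v i)) 1 := by omega
          exact_mod_cast this
        · have h1 := tor_le_dM n k u v i
          have : max (tor n (u i) (v i)) 1 ≤ dM n k u v := by omega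
          exact_mod_cast this
    _ ≤ ∑ v : Node n k, ∏ i, ((max (tor n (u i) (v i)) 1 : ℕ):ℝ)^(-b) := by
        apply Finset.sum_le_sum_of_subset_of_nonneg (Finset.subset_univ _)
        intro _ _ _
        exact Finset.prod_nonneg fun _ _ => by positivity
    _ = ∏ i : Fin k, ∑ x : Fin n, ((max (tor n (u i) x) 1 : ℕ):ℝ)^(-b) := by
        rw [Finset.prod_univ_sum]; simp
    _ ≤ ∏ i : Fin k, (4 * (1 + 1 / (1 - b)) * (n:ℝ)^(1-b)) := by
        apply Finset.prod_le_prod (fun _ _ => Finset.sum_nonneg fun _ _ => by positivity)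
        intro i _
        exact sum_tor_le b hb0 hb1 n hn (u i)
    _ = _ := by
        rw [Finset.prod_const, Finset.card_univ, Fintype.card_fin, mul_pow]
        congr 1
        rw [← Real.rpow_natCast ((n:ℝ)^(1-b)), ← Real.rpow_mul (by positivity)]
        congr 1; linarith

lemma pow_win (C a b : ℝ) (hab : a < b) : ∃ N : ℕ, ∀ n : ℕ, N ≤ n → C * (n:ℝ)^a < (n:ℝ)^b := by
  have h := (tendsto_rpow_atTop (by linarith : 0 < b - a)).comp (tendsto_natCast_atTop_atTop (R := ℝ))
  have h2 := h.eventually_gt_atTop C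
  obtain ⟨N, hN⟩ := Filter.eventually_atTop.1 h2
  refine ⟨max N 1, fun n hn => ?_⟩
  have h3 := hN n (by omega)
  have hn0 : (0:ℝ) < n := by
    have : 0 < n := by omega
    exact_mod_cast this
  simp only [Function.comp] at h3
  calc C * (n:ℝ)^a < (n:ℝ)^(b-a) * (n:ℝ)^a := by
        apply mul_lt_mul_of_pos_right h3; positivity
    _ = _ := by rw [← Real.rpow_add hn0]; congr 1; ring

end DRB
namespace DRB

/-- the coefficient `D(s)/c(s)`. -/
def coef (n k : ℕ) (u : Node n k) (s : ℝ) : ℝ := cnorm n k u (s - 1) / cnorm n k u s ^ 2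

lemma payoff_eq (n k : ℕ) (r : Node n k → ℝ) (u : Node n k) (s : ℝ) :
    payoff n k (Function.update r u s) u =
      ∑ v ∈ others n k u, linkProb n k v u (r v) * (coef n k u s * (dM n k u v : ℝ)^(-s)) := by
  have h1 : linkDist n k u s = cnorm n k u (s-1) / cnorm n k u s := by
    unfold linkDist linkProb
    conv_rhs => unfold cnorm
    rw [Finset.sum_div]
    apply Finset.sum_congr rfl
    intro v hv
    have hd := dpos n k u v hv
    rw [show -(s-1) = -s + 1 by ring, Real.rpow_add (by linarith), Real.rpow_one]
    unfold cnorm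
    ring
  have h2 : recip n k (Function.update r u s) u = ∑ v ∈ others n k u, linkProb n k u v s * linkProb n k v u (r v) := by
    unfold recip
    apply Finset.sum_congr rfl
    intro v hv
    rw [Function.update_self, Function.update_of_ne ((mem_others _ _ _ _).1 hv)]
  unfold payoff
  rw [Function.update_self, h1, h2, Finset.mul_sum]
  apply Finset.sum_congr rfl
  intro v hv
  unfold coef
  rw [linkProb]
  generalize linkProb n k v u (r v) = q
  generalize cnorm n k u (s-1) = a
  generalize cnorm n k u s = b
  field_simp

lemma coef_high (n k : ℕ) (hn : 3 ≤ n) (hk : 1 ≤ k) (u : Node n k) (s a : ℝ) (h : a ≤ s) :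
    coef n k u s ≤ cnorm n k u (a - 1) := by
  have h1 := cnorm_ge_one n k hn hk u s
  have h2 := cnorm_anti n k u (a-1) (s-1) (by linarith)
  have h3 := cnorm_ge_one n k hn hk u (s-1)
  refine le_trans ?_ h2
  exact div_le_self (by linarith) (one_le_pow₀ h1)

lemma coef_low (n k : ℕ) (hn : 3 ≤ n) (hk : 1 ≤ k) (u : Node n k) (s : ℝ) (h0 : 0 ≤ s) (hs : s ≤ k) :
    coef n k u s ≤ 2 * (k:ℝ)^((k:ℝ)+1) * (n:ℝ)^(1 + s - k) := by
  have hc1 := cnorm_ge_one n k hn hk u s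
  have hL := cnorm_lower n k hn hk u s h0
  have hk1 : (1:ℝ) ≤ k := by exact_mod_cast hk
  have hn0 : (0:ℝ) < n := by
    have : 0 < n := by omega
    exact_mod_cast this
  have h1 : cnorm n k u (s-1) ≤ (k * n) * cnorm n k u s := by
    unfold cnorm
    rw [Finset.mul_sum]
    apply Finset.sum_le_sum
    intro v hv
    have hd := dpos n k u v hv
    rw [show -(s-1) = 1 + -s by ring, Real.rpow_add (by linarith), Real.rpow_one]
    gcongr
    exact dle n k u v
  unfold coef
  rw [div_le_iff₀ (by positivity)]
  have e : 2 * (k:ℝ)^(1+s) * (n:ℝ)^(1+s-k) * ((n:ℝ) ^ (k:ℝ) / 2 * ((k:ℝ) * n) ^ (-s)) = k * n := by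
    rw [Real.mul_rpow (by linarith) hn0.le, Real.rpow_sub hn0, Real.rpow_add hn0, Real.rpow_add (by linarith),
      Real.rpow_neg (by linarith), Real.rpow_neg (by linarith), Real.rpow_one, Real.rpow_one]
    field_simp
  calc cnorm n k u (s-1) ≤ (k * n) * cnorm n k u s := h1
    _ = 2 * (k:ℝ)^(1+s) * (n:ℝ)^(1+s-k) * ((n:ℝ) ^ (k:ℝ) / 2 * ((k:ℝ) * n) ^ (-s)) * cnorm n k u s := by rw [e]
    _ ≤ 2 * (k:ℝ)^((k:ℝ)+1) * (n:ℝ)^(1+s-k) * cnorm n k u s * cnorm n k u s := by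
        have hpow : (k:ℝ)^(1+s) ≤ (k:ℝ)^((k:ℝ)+1) :=
          Real.rpow_le_rpow_of_exponent_le hk1 (by linarith)
        gcongr
    _ = _ := by ring

lemma coef_k (n k : ℕ) (hn : 3 ≤ n) (hk : 1 ≤ k) (u : Node n k) (ε C : ℝ) (hε : 0 ≤ ε) (hC : 0 < C)
    (hU : cnorm n k u (k - ε) ≤ C * (n:ℝ)^((k:ℝ) - (k - ε))) :
    (2 * (k:ℝ)^(k:ℝ) * C^2)⁻¹ * (n:ℝ)^(1 - 2 * ε) ≤ coef n k u k := by
  have hc1 := cnorm_ge_one n k hn hk u k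
  have hk1 : (1:ℝ) ≤ k := by exact_mod_cast hk
  have hL := cnorm_lower n k hn hk u (k-1) (by linarith)
  have hn0 : (0:ℝ) < n := by
    have : 0 < n := by omega
    exact_mod_cast this
  have h1 : cnorm n k u k ≤ C * (n:ℝ)^ε := by
    have := cnorm_anti n k u (k-ε) k (by linarith)
    rw [show (k:ℝ) - (k - ε) = ε by ring] at hU
    linarith
  have hL2 : (2 * (k:ℝ)^(k:ℝ))⁻¹ * n ≤ cnorm n k u (k-1) := by
    refine le_trans ?_ hL
    have : (n:ℝ) ^ (k:ℝ) / 2 * ((k:ℝ) * n) ^ (-((k:ℝ)-1)) = k * ((2 * (k:ℝ)^(k:ℝ))⁻¹ * n) := by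
      rw [show -((k:ℝ)-1) = 1 - k by ring, Real.mul_rpow (by linarith) hn0.le, Real.rpow_sub hn0, Real.rpow_sub (by linarith), Real.rpow_one, Real.rpow_one]
      field_simp
    rw [this]
    exact le_mul_of_one_le_left (by positivity) hk1
  unfold coef
  rw [le_div_iff₀ (by positivity)]
  calc (2 * (k:ℝ)^(k:ℝ) * C^2)⁻¹ * (n:ℝ)^(1 - 2 * ε) * cnorm n k u k ^ 2
      ≤ (2 * (k:ℝ)^(k:ℝ) * C^2)⁻¹ * (n:ℝ)^(1 - 2 * ε) * (C * (n:ℝ)^ε) ^ 2 := by gcongr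
    _ = (2 * (k:ℝ)^(k:ℝ))⁻¹ * n := by
        rw [Real.rpow_sub hn0, mul_comm 2 ε, Real.rpow_mul hn0.le, Real.rpow_one,
          show ((n:ℝ)^ε)^(2:ℝ) = ((n:ℝ)^ε)^2 from Real.rpow_natCast _ 2]
        field_simp
    _ ≤ _ := hL2

lemma linkProb_pos (n k : ℕ) (hn : 3 ≤ n) (hk : 1 ≤ k) (u v : Node n k) (h : v ≠ u) (ρ : ℝ) :
    0 < linkProb n k u v ρ := by
  have h1 := cnorm_ge_one n k hn hk u ρ
  have h2 : (0:ℝ) < dM n k u v := by exact_mod_cast dM_pos n k u v h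
  unfold linkProb
  positivity

set_option maxHeartbeats 1600000 in
/-- If a node sees a suitable close node, then `k` is its unique best response. -/
lemma best_k (k : ℕ) (hk : 1 ≤ k) (γ : ℝ) (hγ0 : 0 < γ) (hγ1 : γ ≤ 1 / 2) :
    ∃ N : ℕ, ∀ n : ℕ, N ≤ n → ∀ r : Node n k → ℝ, (∀ w, 0 ≤ r w) → ∀ u v : Node n k, v ≠ u →
      ((dM n k u v = 1 ∧ γ ≤ r v) ∨ (dM n k u v ≤ 2 ∧ r v = k)) →
      ∀ s : ℝ, 0 ≤ s → (s ≤ k - γ ∨ k + γ ≤ s) →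
        payoff n k (Function.update r u s) u < payoff n k (Function.update r u k) u := by
  have hk1 : (1:ℝ) ≤ k := by exact_mod_cast hk
  set δ := γ / (4 * k) with hδ
  have hδ0 : 0 < δ := by positivity
  have hδk : δ * k = γ / 4 := by rw [hδ]; field_simp
  have hδ1 : δ ≤ γ / 4 := by nlinarith
  set ε := γ * δ / 4 with hε
  have hε0 : 0 < ε := by positivity
  have hε1 : 4 * ε = γ * δ := by rw [hε]; ring
  have hε2 : ε ≤ γ / 32 := by nlinarith
  obtain ⟨Cγ, hCγ, Uγ⟩ := cnorm_upper k hk γ hγ0.le (by linarith)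
  obtain ⟨Cε, hCε, Uε⟩ := cnorm_upper k hk (k - ε) (by linarith) (by linarith)
  obtain ⟨C3, hC3, U3⟩ := cnorm_upper k hk (k + γ - 1) (by linarith) (by linarith)
  set c1 := (2 * (k:ℝ)^(k:ℝ) * Cε^2)⁻¹ with hc1
  have hc10 : 0 < c1 := by positivity
  set C4 := 2 * (k:ℝ)^((k:ℝ)+1) with hC4
  have hC40 : 0 < C4 := by positivity
  set C5 := 2 * (k:ℝ)^(k:ℝ) with hC5
  have hC50 : 0 < C5 := by positivity
  set c6 := (2:ℝ)^(-(k:ℝ)) * Cγ⁻¹ with hc6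
  have hc60 : 0 < c6 := by positivity
  set c7 := c6 * (c1 * (2:ℝ)^(-(k:ℝ))) with hc7
  have hc70 : 0 < c7 := by positivity
  clear_value c7 c6 c1 C4 C5 ε δ
  obtain ⟨N1, E1⟩ := pow_win (C3 / c1) (1 - γ) (1 - 2 * ε) (by linarith)
  obtain ⟨N2, E2⟩ := pow_win (2 * C4 / c1) (1 - δ * γ) (1 - 2 * ε) (by nlinarith)
  obtain ⟨N3, E3⟩ := pow_win (2 * (C5 * C4) / c7) (1 - k + γ / 2) (1 - k + γ - 2 * ε) (by linarith)
  refine ⟨max (max N1 N2) (max N3 3), ?_⟩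
  intro n hn r hr u v hvu hv s hs0 hs
  have hn3 : 3 ≤ n := by omega
  have hn1 : (1:ℝ) ≤ n := by
    have : 1 ≤ n := by omega
    exact_mod_cast this
  have hn0 : (0:ℝ) < n := by linarith
  specialize E1 n (by omega)
  specialize E2 n (by omega)
  specialize E3 n (by omega)
  have hvm : v ∈ others n k u := (mem_others _ _ _ _).2 hvu
  have hF := coef_k n k hn3 hk u ε Cε hε0.le hCε (Uε n (by omega) u)
  rw [← hC5, ← hc1] at hF
  set q : Node n k → ℝ := fun w => linkProb n k w u (r w) with hq
  have hq0 : ∀ w ∈ others n k u, 0 < q w := by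
    intro w hw
    exact linkProb_pos n k hn3 hk w u ((mem_others _ _ _ _).1 hw).symm _
  rw [payoff_eq, payoff_eq]
  rcases hs with hs | hs
  swap
  · -- high strategies: pointwise domination
    apply Finset.sum_lt_sum_of_nonempty ⟨v, hvm⟩
    intro w hw
    apply mul_lt_mul_of_pos_left _ (hq0 w hw)
    have hd := dpos n k u w hw
    have h1 := coef_high n k hn3 hk u s (k + γ) hs
    have h2 := U3 n (by omega) u
    rw [show (k:ℝ) - (k + γ - 1) = 1 - γ by ring] at h2
    have h3 : C3 * (n:ℝ)^(1-γ) < c1 * (n:ℝ)^(1 - 2*ε) := by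
      rw [div_mul_eq_mul_div, div_lt_iff₀ hc10] at E1
      linarith
    have h4 : coef n k u s < coef n k u k := by linarith
    have hp : 0 < coef n k u k := lt_of_lt_of_le (by positivity) hF
    calc coef n k u s * (dM n k u w:ℝ)^(-s) < coef n k u k * (dM n k u w:ℝ)^(-s) := by
          apply mul_lt_mul_of_pos_right h4; positivity
      _ ≤ coef n k u k * (dM n k u w:ℝ)^(-(k:ℝ)) := by
          apply mul_le_mul_of_nonneg_left _ hp.le
          exact Real.rpow_le_rpow_of_exponent_le hd (by linarith)
  · -- low strategies
    have hlow := coef_low n k hn3 hk u s hs0 (by linarith)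
    rw [← hC4] at hlow
    have hp : 0 < coef n k u k := lt_of_lt_of_le (by positivity) hF
    have hcs : 0 ≤ coef n k u s := by
      have h1 := cnorm_ge_one n k hn3 hk u s
      have h2 := cnorm_ge_one n k hn3 hk u (s-1)
      unfold coef; positivity
    have hterm : ∀ w ∈ others n k u, q w * (coef n k u s * (dM n k u w:ℝ)^(-s)) ≤
        1/2 * (q w * (coef n k u k * (dM n k u w:ℝ)^(-(k:ℝ)))) + C5 * C4 * (n:ℝ)^(1 - 2 * k + γ/2) := by
      intro w hw
      have hd := dpos n k u w hw
      have hd0 : (0:ℝ) < dM n k u w := by linarith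
      have hqw := hq0 w hw
      by_cases hnear : (dM n k u w:ℝ) ≤ (n:ℝ)^(1-δ)
      · have g1 : coef n k u s * (dM n k u w:ℝ)^(-s) ≤ 1/2 * (coef n k u k * (dM n k u w:ℝ)^(-(k:ℝ))) := by
          calc coef n k u s * (dM n k u w:ℝ)^(-s) ≤ C4 * (n:ℝ)^(1+s-k) * (dM n k u w:ℝ)^(-s) := by gcongr
            _ = C4 * (n:ℝ)^(1+s-k) * (dM n k u w:ℝ)^((k:ℝ)-s) * (dM n k u w:ℝ)^(-(k:ℝ)) := by
                rw [mul_assoc _ _ ((dM n k u w:ℝ)^(-(k:ℝ))), ← Real.rpow_add hd0]; congr 2; ring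
            _ ≤ C4 * (n:ℝ)^(1+s-k) * ((n:ℝ)^(1-δ))^((k:ℝ)-s) * (dM n k u w:ℝ)^(-(k:ℝ)) := by
                have : 0 ≤ (k:ℝ) - s := by linarith
                gcongr
            _ = C4 * (n:ℝ)^(1 - δ * (k-s)) * (dM n k u w:ℝ)^(-(k:ℝ)) := by
                rw [← Real.rpow_mul hn0.le, mul_assoc C4, ← Real.rpow_add hn0]; congr 3; ring
            _ ≤ C4 * (n:ℝ)^(1 - δ * γ) * (dM n k u w:ℝ)^(-(k:ℝ)) := by
                gcongr
                linarith
            _ ≤ 1/2 * (c1 * (n:ℝ)^(1 - 2*ε)) * (dM n k u w:ℝ)^(-(k:ℝ)) := by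
                apply mul_le_mul_of_nonneg_right _ (by positivity)
                rw [div_mul_eq_mul_div, div_lt_iff₀ hc10] at E2
                linarith
            _ ≤ 1/2 * coef n k u k * (dM n k u w:ℝ)^(-(k:ℝ)) := by gcongr
            _ = _ := by ring
        have g2 := mul_le_mul_of_nonneg_left g1 hqw.le
        have g3 : 0 ≤ C5 * C4 * (n:ℝ)^(1 - 2 * k + γ/2) := by positivity
        linarith
      · have hfar : (n:ℝ)^(1-δ) ≤ dM n k u w := (not_le.1 hnear).le
        have g1 : q w ≤ C5 * (dM n k u w:ℝ)^(-(k:ℝ)) := by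
          have := linkProb_upper n k hn3 hk w u ((mem_others _ _ _ _).1 hw).symm (r w) (hr w)
          rw [dM_comm n k w u, ← hC5] at this
          exact this
        have g2 : q w * (coef n k u s * (dM n k u w:ℝ)^(-s)) ≤ C5 * C4 * (n:ℝ)^(1 - 2 * k + γ/2) := by
          calc q w * (coef n k u s * (dM n k u w:ℝ)^(-s))
              ≤ (C5 * (dM n k u w:ℝ)^(-(k:ℝ))) * ((C4 * (n:ℝ)^(1+s-k)) * (dM n k u w:ℝ)^(-s)) := by gcongr
            _ = C5 * C4 * (n:ℝ)^(1+s-k) * (dM n k u w:ℝ)^(-((k:ℝ)+s)) := by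
                rw [neg_add, Real.rpow_add hd0]; ring
            _ ≤ C5 * C4 * (n:ℝ)^(1+s-k) * ((n:ℝ)^(1-δ))^(-((k:ℝ)+s)) := by
                apply mul_le_mul_of_nonneg_left _ (by positivity)
                exact Real.rpow_le_rpow_of_nonpos (by positivity) hfar (by linarith)
            _ = C5 * C4 * (n:ℝ)^(1 - 2 * k + δ * (k + s)) := by
                rw [← Real.rpow_mul hn0.le, mul_assoc (C5 * C4), ← Real.rpow_add hn0]; congr 2; ring
            _ ≤ _ := by
                gcongr
                nlinarith
        have g3 : 0 ≤ q w * (coef n k u k * (dM n k u w:ℝ)^(-(k:ℝ))) := by positivity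
        linarith
    have hsum := Finset.sum_le_sum hterm
    rw [Finset.sum_add_distrib, ← Finset.mul_sum, Finset.sum_const, nsmul_eq_mul] at hsum
    have hcard : ((others n k u).card : ℝ) ≤ (n:ℝ)^(k:ℝ) := by
      rw [card_others, Real.rpow_natCast]
      exact_mod_cast Nat.sub_le _ _
    have hfarsum : ((others n k u).card : ℝ) * (C5 * C4 * (n:ℝ)^(1 - 2 * k + γ/2)) ≤ C5 * C4 * (n:ℝ)^(1 - k + γ/2) := by
      calc _ ≤ (n:ℝ)^(k:ℝ) * (C5 * C4 * (n:ℝ)^(1 - 2 * k + γ/2)) := by gcongr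
        _ = C5 * C4 * ((n:ℝ)^(k:ℝ) * (n:ℝ)^(1 - 2 * k + γ/2)) := by ring
        _ = _ := by rw [← Real.rpow_add hn0]; congr 2; ring
    have hqv : c6 * (n:ℝ)^(γ - k) ≤ q v := by
      have hUv := Uγ n (by omega) v
      have hcv := cnorm_ge_one n k hn3 hk v (r v)
      have hrv : γ ≤ r v := by rcases hv with hv | hv <;> linarith [hv.2]
      have h1 : cnorm n k v (r v) ≤ Cγ * (n:ℝ)^((k:ℝ) - γ) := (cnorm_anti n k v γ (r v) hrv).trans hUv
      have h2 : (2:ℝ)^(-(k:ℝ)) ≤ (dM n k v u:ℝ)^(-(r v)) := by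
        rw [dM_comm]
        rcases hv with hv | hv
        · rw [hv.1]; simp only [Nat.cast_one, Real.one_rpow]
          exact Real.rpow_le_one_of_one_le_of_nonpos (by norm_num) (by linarith)
        · rw [hv.2]
          have := dpos n k u v hvm
          exact Real.rpow_le_rpow_of_nonpos (by linarith) (by exact_mod_cast hv.1) (by linarith)
      simp only [hq, linkProb]
      rw [le_div_iff₀ (by linarith)]
      refine le_trans ?_ h2
      calc c6 * (n:ℝ)^(γ - k) * cnorm n k v (r v) ≤ c6 * (n:ℝ)^(γ - k) * (Cγ * (n:ℝ)^((k:ℝ) - γ)) := by gcongr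
        _ = (2:ℝ)^(-(k:ℝ)) * (Cγ⁻¹ * Cγ) * ((n:ℝ)^(γ - k) * (n:ℝ)^((k:ℝ) - γ)) := by rw [hc6]; ring
        _ = (2:ℝ)^(-(k:ℝ)) := by
          rw [← Real.rpow_add hn0, inv_mul_cancel₀ hCγ.ne']; simp
    have hvterm : c7 * (n:ℝ)^(1 - k + γ - 2*ε) ≤ q v * (coef n k u k * (dM n k u v:ℝ)^(-(k:ℝ))) := by
      have hd2 : (2:ℝ)^(-(k:ℝ)) ≤ (dM n k u v:ℝ)^(-(k:ℝ)) := by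
        have := dpos n k u v hvm
        have h2 : dM n k u v ≤ 2 := by rcases hv with hv | hv <;> omega
        exact Real.rpow_le_rpow_of_nonpos (by linarith) (by exact_mod_cast h2) (by linarith)
      calc c7 * (n:ℝ)^(1 - k + γ - 2*ε) = (c6 * (n:ℝ)^(γ - k)) * ((c1 * (n:ℝ)^(1 - 2*ε)) * (2:ℝ)^(-(k:ℝ))) := by
            rw [show 1 - (k:ℝ) + γ - 2*ε = (γ - k) + (1 - 2*ε) by ring, Real.rpow_add hn0, hc7]; ring
        _ ≤ _ := by
            have := hq0 v hvm
            gcongr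
    have hall : q v * (coef n k u k * (dM n k u v:ℝ)^(-(k:ℝ))) ≤
        ∑ w ∈ others n k u, q w * (coef n k u k * (dM n k u w:ℝ)^(-(k:ℝ))) := by
      apply Finset.single_le_sum (f := fun w => q w * (coef n k u k * (dM n k u w:ℝ)^(-(k:ℝ)))) _ hvm
      intro w hw
      have := hq0 w hw
      positivity
    rw [div_mul_eq_mul_div, div_lt_iff₀ hc70] at E3
    refine lt_of_le_of_lt hsum ?_
    linarith

end DRB

namespace DRB

lemma sigma_nonneg (g : ℕ) (s : ℝ) (h : InSigma (g:ℝ)⁻¹ s) : 0 ≤ s := by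
  obtain ⟨m, rfl⟩ := h; positivity

lemma sigma_pos (g : ℕ) (hg : 2 ≤ g) (s : ℝ) (h : InSigma (g:ℝ)⁻¹ s) (h0 : 0 < s) : (g:ℝ)⁻¹ ≤ s := by
  obtain ⟨m, rfl⟩ := h
  have : 1 ≤ m := by
    rcases Nat.eq_zero_or_pos m with rfl | h
    · simp at h0
    · exact h
  have h1 : (1:ℝ) ≤ m := by exact_mod_cast this
  exact le_mul_of_one_le_left (by positivity) h1

lemma sigma_k (g k : ℕ) (hg : 2 ≤ g) : InSigma (g:ℝ)⁻¹ k :=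
  ⟨k * g, by
    have : (g:ℝ) ≠ 0 := by
      have : g ≠ 0 := by omega
      exact_mod_cast this
    push_cast; field_simp⟩

lemma sigma_sep (g k : ℕ) (hg : 2 ≤ g) (s : ℝ) (h : InSigma (g:ℝ)⁻¹ s) (hne : s ≠ k) :
    s ≤ k - (g:ℝ)⁻¹ ∨ k + (g:ℝ)⁻¹ ≤ s := by
  obtain ⟨m, rfl⟩ := h
  have hg0 : (0:ℝ) < g := by
    have : 0 < g := by omega
    exact_mod_cast this
  have hk : (k:ℝ) = (k * g) * (g:ℝ)⁻¹ := by field_simp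
  rcases lt_trichotomy m (k * g) with h | h | h
  · left
    have : (m:ℝ) + 1 ≤ k * g := by exact_mod_cast h
    have h2 := mul_le_mul_of_nonneg_right this (inv_nonneg.2 hg0.le)
    rw [← hk] at h2
    linarith
  · exfalso; apply hne; rw [h]; push_cast; exact hk.symm
  · right
    have : (k:ℝ) * g + 1 ≤ m := by exact_mod_cast h
    have h2 := mul_le_mul_of_nonneg_right this (inv_nonneg.2 hg0.le)
    rw [add_mul, ← hk] at h2
    linarith

end DRB

/-- For sufficiently large `n`, starting from any profile `r ≢ 0`,
the synchronous best-response dynamic reaches the navigable profile `r ≡ k`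
after at most `k·⌊n/2⌋` synchronous steps (and stays there). -/
theorem navigable_reached_sync (k g : ℕ) (hk : 1 ≤ k) (hg : 2 ≤ g) :
    ∃ n0 : ℕ, ∀ n : ℕ, n0 ≤ n →
      ∀ seq : ℕ → (DRB.Node n k → ℝ),
        DRB.ValidProfile n k (g : ℝ)⁻¹ (seq 0) →
        (∃ u : DRB.Node n k, 0 < seq 0 u) →
        (∀ t : ℕ, DRB.SyncStep n k (g : ℝ)⁻¹ (seq t) (seq (t + 1))) →
        ∀ t : ℕ, k * (n / 2) ≤ t → seq t = fun _ => (k : ℝ) := by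
  have hg2 : (2:ℝ) ≤ g := by exact_mod_cast hg
  have hγ0 : (0:ℝ) < (g:ℝ)⁻¹ := by positivity
  have hγ1 : (g:ℝ)⁻¹ ≤ 1/2 := by
    rw [one_div]; exact inv_anti₀ (by norm_num) hg2
  have hk1 : (1:ℝ) ≤ k := by exact_mod_cast hk
  obtain ⟨N, hN⟩ := DRB.best_k k hk (g:ℝ)⁻¹ hγ0 hγ1
  refine ⟨max N 4, ?_⟩
  intro n hn seq hv0 hpos hstep
  have hn4 : 4 ≤ n := by omega
  have hvalid : ∀ t, ∀ u, DRB.InSigma (g:ℝ)⁻¹ (seq t u) := by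
    intro t
    cases t with
    | zero => exact hv0
    | succ t => exact fun u => (hstep t u).1
  have hbr : ∀ t, ∀ u v : DRB.Node n k, v ≠ u →
      ((DRB.dM n k u v = 1 ∧ (g:ℝ)⁻¹ ≤ seq t v) ∨ (DRB.dM n k u v ≤ 2 ∧ seq t v = k)) →
      seq (t+1) u = k := by
    intro t u v hvu hc
    by_contra hne
    have hs := DRB.sigma_sep g k hg _ (hvalid (t+1) u) hne
    have h1 := hN n (by omega) (seq t) (fun w => DRB.sigma_nonneg g _ (hvalid t w)) u v hvu hc
      (seq (t+1) u) (DRB.sigma_nonneg g _ (hvalid (t+1) u)) hs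
    have h2 := (hstep t u).2 k (DRB.sigma_k g k hg)
    linarith
  have hne1 : ∀ a b : DRB.Node n k, DRB.dM n k a b = 1 → b ≠ a := by
    rintro a b h rfl
    rw [DRB.dM_self] at h; omega
  obtain ⟨v, hv⟩ := hpos
  have hvγ := DRB.sigma_pos g hg _ (hv0 v) hv
  -- after one step: the sphere of radius one
  have S1 : ∀ u, DRB.dM n k v u = 1 → seq 1 u = k := by
    intro u hu
    exact hbr 0 u v (hne1 v u hu).symm (Or.inl ⟨by rw [DRB.dM_comm]; exact hu, hvγ⟩)
  obtain ⟨w, w', hww, hw, hw'⟩ := DRB.exists_two n k (by omega) hk v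
  have S2 : ∀ t, ∀ u, DRB.dM n k v u ≤ t + 2 → seq (t+2) u = k := by
    intro t
    induction t with
    | zero =>
      intro u hu
      by_cases huv : u = v
      · subst huv
        exact hbr 1 u w (hne1 u w hw) (Or.inr ⟨by omega, S1 w hw⟩)
      · obtain ⟨x, hx1, hx2⟩ := DRB.exists_toward n k u v huv
        by_cases h2 : DRB.dM n k v u = 2
        · exact hbr 1 u x (hne1 u x hx1) (Or.inr ⟨by omega, S1 x (by omega)⟩)
        · have h1 : DRB.dM n k v u = 1 := by omega
          have hy : ∃ y, y ≠ u ∧ DRB.dM n k v y = 1 := by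
            by_cases h : w = u
            · exact ⟨w', fun h' => hww (h.trans h'.symm), hw'⟩
            · exact ⟨w, h, hw⟩
          obtain ⟨y, hy1, hy2⟩ := hy
          have htri := DRB.dM_triangle n k u v y
          rw [DRB.dM_comm n k u v] at htri
          exact hbr 1 u y hy1 (Or.inr ⟨by omega, S1 y hy2⟩)
    | succ t ih =>
      intro u hu
      by_cases huv : u = v
      · subst huv
        exact hbr (t+2) u w (hne1 u w hw) (Or.inr ⟨by omega, ih w (by omega)⟩)
      · obtain ⟨x, hx1, hx2⟩ := DRB.exists_toward n k u v huv
        exact hbr (t+2) u x (hne1 u x hx1) (Or.inr ⟨by omega, ih x (by omega)⟩)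
  intro t ht
  have h2 : 2 ≤ k * (n/2) := by
    calc 2 ≤ 1 * (n/2) := by omega
      _ ≤ k * (n/2) := Nat.mul_le_mul_right _ hk
  obtain ⟨t', rfl⟩ : ∃ t', t = t' + 2 := ⟨t - 2, by omega⟩
  funext u
  exact S2 t' u ((DRB.dM_le n k v u).trans ht)
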